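/- There exist constants c > 1 and C > 0 such that for every integer a ≥ 1, every ε > 0, every L that is a power of 2, and all integers m, d1, d2, setting d = ⌈c·(log max{d1, d2} + log(1/ε))⌉, if m ≥ d, d1 ≥ 8a·d + 6m and d2 ≥ 8a·d + c^{a·(log L)^{1/a}}·d, then there exist functions NIPM_x : ({0,1}^m)^L × {0,1}^{d1} × {0,1}^{d2} → {0,1}^m and NIPM_y : ({0,1}^m)^L × {0,1}^{d1} × {0,1}^{d2} → {0,1}^d such that NIPM_x is an (L, d1, d2, C·L·ε)-NIPM that is strong in Y, and NIPM_y is an (L, d1, d2, C·L·ε)-NIPM that is strong in X. -/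

import Mathlib

set_option synthInstance.maxSize 2048
set_option synthInstance.maxHeartbeats 1000000
set_option maxHeartbeats 1000000

noncomputable section

/-- Bit strings of length `n`. -/
abbrev BS (n : ℕ) : Type := Fin n → Bool

/-- Logarithm base 2. -/
def log2 (x : ℝ) : ℝ := Real.logb 2 x

/-- `p` is a probability distribution on the finite type `α`. -/
def IsDist {α : Type*} [Fintype α] (p : α → ℝ) : Prop :=
  (∀ a, 0 ≤ p a) ∧ ∑ a, p a = 1

/-- Statistical (total variation) distance between two distributions on a finite type. -/
def sd {α : Type*} [Fintype α] (p q : α → ℝ) : ℝ :=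
  (∑ a, |p a - q a|) / 2

/-- Pushforward of a distribution along a function (the distribution of `f(X)` for `X ~ p`). -/
def distMap {α β : Type*} [Fintype α] [DecidableEq β] (f : α → β) (p : α → ℝ) : β → ℝ :=
  fun b => ∑ a, if f a = b then p a else 0

/-- Product (independent joint) distribution. -/
def prodDist {α β : Type*} (p : α → ℝ) (q : β → ℝ) : α × β → ℝ :=
  fun x => p x.1 * q x.2

/-- Uniform distribution on a finite type. -/
def unifDist (α : Type*) [Fintype α] : α → ℝ :=
  fun _ => 1 / (Fintype.card α : ℝ)

/-- The distribution `p` has min-entropy at least `k` (k real, logs base 2). -/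
def minEntropyGe {α : Type*} (p : α → ℝ) (k : ℝ) : Prop :=
  ∀ a, p a ≤ (2 : ℝ) ^ (-k)

/-- `F` is an `(L, d1, d2, ε)`-non-malleable independence preserving merger (with an
additional source) that is *strong in Y*: whenever `(V, V')` are random `L×m` boolean
matrices with every row of `V` uniform and some row `h` with `(V_h, V'_h) = (U_m, V'_h)`,
`(X, X')` are on `d1` bits with `X` uniform conditioned on `(V, V')`, and `(Y, Y')` are on
`d2` bits with `Y` uniform and `(Y, Y')` independent of `(V, V', X, X')`, then, writing
`W = F(V,X,Y)`, `W' = F(V',X',Y')`, we have `(W, W', Y, Y') ≈_ε (U, W', Y, Y')`. -/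
def IsNIPMStrongY {L m d1 d2 m1 : ℕ}
    (F : (Fin L → BS m) → BS d1 → BS d2 → BS m1) (ε : ℝ) : Prop :=
  ∀ (Ω : Type) [Fintype Ω] (μ : Ω → ℝ), IsDist μ →
    ∀ (V V' : Ω → Fin L → BS m) (X X' : Ω → BS d1) (Y Y' : Ω → BS d2),
      (∀ i : Fin L, distMap (fun ω => V ω i) μ = unifDist (BS m)) →
      (∃ h : Fin L, distMap (fun ω => (V ω h, V' ω h)) μ
          = prodDist (unifDist (BS m)) (distMap (fun ω => V' ω h) μ)) →
      (distMap (fun ω => ((V ω, V' ω), X ω)) μ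
          = prodDist (distMap (fun ω => (V ω, V' ω)) μ) (unifDist (BS d1))) →
      (distMap Y μ = unifDist (BS d2)) →
      (distMap (fun ω => ((V ω, V' ω, X ω, X' ω), (Y ω, Y' ω))) μ
          = prodDist (distMap (fun ω => (V ω, V' ω, X ω, X' ω)) μ)
              (distMap (fun ω => (Y ω, Y' ω)) μ)) →
      sd (distMap (fun ω =>
            (F (V ω) (X ω) (Y ω), F (V' ω) (X' ω) (Y' ω), Y ω, Y' ω)) μ)
         (distMap (fun p : BS m1 × Ω =>
            (p.1, F (V' p.2) (X' p.2) (Y' p.2), Y p.2, Y' p.2))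
            (prodDist (unifDist (BS m1)) μ)) ≤ ε

/-- Same as `IsNIPMStrongY`, but *strong in X*:
`(W, W', X, X') ≈_ε (U, W', X, X')`. -/
def IsNIPMStrongX {L m d1 d2 m1 : ℕ}
    (F : (Fin L → BS m) → BS d1 → BS d2 → BS m1) (ε : ℝ) : Prop :=
  ∀ (Ω : Type) [Fintype Ω] (μ : Ω → ℝ), IsDist μ →
    ∀ (V V' : Ω → Fin L → BS m) (X X' : Ω → BS d1) (Y Y' : Ω → BS d2),
      (∀ i : Fin L, distMap (fun ω => V ω i) μ = unifDist (BS m)) →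
      (∃ h : Fin L, distMap (fun ω => (V ω h, V' ω h)) μ
          = prodDist (unifDist (BS m)) (distMap (fun ω => V' ω h) μ)) →
      (distMap (fun ω => ((V ω, V' ω), X ω)) μ
          = prodDist (distMap (fun ω => (V ω, V' ω)) μ) (unifDist (BS d1))) →
      (distMap Y μ = unifDist (BS d2)) →
      (distMap (fun ω => ((V ω, V' ω, X ω, X' ω), (Y ω, Y' ω))) μ
          = prodDist (distMap (fun ω => (V ω, V' ω, X ω, X' ω)) μ)
              (distMap (fun ω => (Y ω, Y' ω)) μ)) →
      sd (distMap (fun ω =>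
            (F (V ω) (X ω) (Y ω), F (V' ω) (X' ω) (Y' ω), X ω, X' ω)) μ)
         (distMap (fun p : BS m1 × Ω =>
            (p.1, F (V' p.2) (X' p.2) (Y' p.2), X p.2, X' p.2))
            (prodDist (unifDist (BS m1)) μ)) ≤ ε

/-! ### Counting part -/

lemma tail_bound {Yt O : Type} [Fintype Yt] [Fintype O] [DecidableEq Yt] [DecidableEq O]
    [Nonempty O]
    (ψ : Yt → O → ℝ) (h1 : ∀ y u, |ψ y u| ≤ 1) (h0 : ∀ y, ∑ u, ψ y u = 0)
    (δ : ℝ) (hδ0 : 0 ≤ δ) (hδ2 : δ ≤ 2) :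
    (∑ r : Yt → O, if δ * Fintype.card Yt < ∑ y, ψ y (r y) then (1 : ℝ) else 0)
      ≤ Real.exp (-(δ ^ 2 * Fintype.card Yt / 4)) * Fintype.card (Yt → O) := by
  have step1 : (∑ r : Yt → O, if δ * Fintype.card Yt < ∑ y, ψ y (r y) then (1 : ℝ) else 0)
      ≤ ∑ r : Yt → O, Real.exp (-(δ / 2 * (δ * Fintype.card Yt)))
          * ∏ y, Real.exp (δ / 2 * ψ y (r y)) := by
    refine Finset.sum_le_sum fun r _ => ?_
    rw [← Real.exp_sum, ← Real.exp_add, ← Finset.mul_sum]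
    split_ifs with h
    · refine Real.one_le_exp ?_
      nlinarith
    · exact (Real.exp_pos _).le
  refine step1.trans ?_
  rw [← Finset.mul_sum]
  have step2 : ∑ r : Yt → O, ∏ y, Real.exp (δ / 2 * ψ y (r y))
      = ∏ y, ∑ u, Real.exp (δ / 2 * ψ y u) := by
    rw [Finset.prod_univ_sum]
    simp [Fintype.piFinset_univ]
  rw [step2]
  have step3 : ∏ y, ∑ u, Real.exp (δ / 2 * ψ y u)
      ≤ ∏ _y : Yt, ((Fintype.card O : ℝ) * Real.exp ((δ / 2) ^ 2)) := by
    refine Finset.prod_le_prod (fun y _ => Finset.sum_nonneg fun u _ => (Real.exp_pos _).le) ?_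
    intro y _
    have : ∑ u, Real.exp (δ / 2 * ψ y u) ≤ ∑ u, (1 + δ / 2 * ψ y u + (δ / 2) ^ 2) := by
      refine Finset.sum_le_sum fun u _ => ?_
      have hu := h1 y u
      have habs : |δ / 2 * ψ y u| ≤ δ / 2 := by
        rw [abs_mul, abs_of_nonneg (by linarith : (0 : ℝ) ≤ δ / 2)]
        nlinarith
      have hb := Real.abs_exp_sub_one_sub_id_le (x := δ / 2 * ψ y u) (by linarith)
      have h3 := (abs_le.1 hb).2
      have h4 : (δ / 2 * ψ y u) ^ 2 ≤ (δ / 2) ^ 2 := by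
        rw [← sq_abs]
        exact pow_le_pow_left₀ (abs_nonneg _) habs 2
      linarith
    refine this.trans ?_
    rw [Finset.sum_add_distrib, Finset.sum_add_distrib, ← Finset.mul_sum, h0 y]
    simp only [Finset.sum_const, Finset.card_univ, nsmul_eq_mul, mul_one, mul_zero, add_zero]
    have := Real.add_one_le_exp ((δ / 2) ^ 2)
    have hc : (0 : ℝ) ≤ Fintype.card O := by positivity
    nlinarith
  refine (mul_le_mul_of_nonneg_left step3 (Real.exp_pos _).le).trans ?_
  rw [Finset.prod_const, mul_pow, ← Real.exp_nat_mul, Finset.card_univ, mul_left_comm,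
    ← Real.exp_add, Fintype.card_fun, mul_comm]
  push_cast
  refine le_of_eq ?_
  congr 2
  ring

lemma sum_update {D R : Type} [Fintype D] [DecidableEq D] [Fintype R] [DecidableEq R]
    (a : D) (h : (D → R) → ℝ) :
    ∑ F : D → R, ∑ r : R, h (Function.update F a r) = Fintype.card R * ∑ F : D → R, h F := by
  rw [← Fintype.sum_prod_type' (f := fun (F : D → R) r => h (Function.update F a r))]
  have : ∑ x : (D → R) × R, h (Function.update x.1 a x.2) = ∑ x : (D → R) × R, h x.1 := by
    refine Finset.sum_nbij' (fun x => (Function.update x.1 a x.2, x.1 a))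
      (fun x => (Function.update x.1 a x.2, x.1 a)) ?_ ?_ ?_ ?_ ?_ <;> simp
  rw [this, Fintype.sum_prod_type]
  simp [Finset.mul_sum]

lemma chain_count {D R ι : Type} [Fintype D] [DecidableEq D] [Fintype R] [DecidableEq R]
    [Nonempty R] [DecidableEq ι] (e : D → ℤ) (u v : ι → D) (hu : Function.Injective u)
    (huv : ∀ i, e (u i) < e (v i)) (E : ι → R → R → Prop) (p : ℝ)
    (hE : ∀ i w, (∑ r : R, open Classical in if E i w r then (1 : ℝ) else 0)
      ≤ p * Fintype.card R) (n : ℕ) :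
    ∀ I : Finset ι, I.card = n →
    (∑ F : D → R, open Classical in if ∀ i ∈ I, E i (F (v i)) (F (u i)) then (1 : ℝ) else 0)
      ≤ p ^ n * Fintype.card (D → R) := by
  classical
  induction n with
  | zero =>
    intro I hI
    rw [Finset.card_eq_zero] at hI
    subst hI
    simp
  | succ n ih =>
    intro I hI
    have hne : I.Nonempty := by
      rw [← Finset.card_pos]; omega
    obtain ⟨i, hi, hmin⟩ := Finset.exists_min_image I (fun i => e (u i)) hne
    have ih' := ih (I.erase i) (by rw [Finset.card_erase_of_mem hi, hI]; rfl)
    have hR : (0 : ℝ) < Fintype.card R := by exact_mod_cast Fintype.card_pos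
    have hp : 0 ≤ p := by
      have := hE i (Classical.arbitrary R)
      have h0 : (0 : ℝ) ≤ ∑ r : R, if E i (Classical.arbitrary R) r then (1 : ℝ) else 0 :=
        Finset.sum_nonneg fun r _ => by split_ifs <;> norm_num
      by_contra hneg
      push Not at hneg
      nlinarith
    have hsum := sum_update (R := R) (u i)
      (fun F : D → R => if ∀ j ∈ I, E j (F (v j)) (F (u j)) then (1 : ℝ) else 0)
    have key : ∀ F : D → R,
        (∑ r : R, (fun F : D → R => if ∀ j ∈ I, E j (F (v j)) (F (u j)) then (1 : ℝ) else 0)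
          (Function.update F (u i) r))
        ≤ (if ∀ j ∈ I.erase i, E j (F (v j)) (F (u j)) then (1 : ℝ) else 0)
            * (p * Fintype.card R) := by
      intro F
      refine le_trans ?_ (mul_le_mul_of_nonneg_left (hE i (F (v i))) (by split_ifs <;> norm_num))
      rw [Finset.mul_sum]
      refine Finset.sum_le_sum fun r _ => ?_
      by_cases hall : ∀ j ∈ I, E j (Function.update F (u i) r (v j)) (Function.update F (u i) r (u j))
      · have hv : ∀ j ∈ I, v j ≠ u i := by
          intro j hj hc
          have h1 := huv j
          have h2 := hmin j hj
          rw [hc] at h1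
          exact absurd h1 (not_lt.2 h2)
        have hA : ∀ j ∈ I.erase i, E j (F (v j)) (F (u j)) := by
          intro j hj
          obtain ⟨hji, hjI⟩ := Finset.mem_erase.1 hj
          have := hall j hjI
          rwa [Function.update_of_ne (hv j hjI), Function.update_of_ne (fun h => hji (hu h))] at this
        have hB : E i (F (v i)) r := by
          have := hall i hi
          rwa [Function.update_of_ne (hv i hi), Function.update_self] at this
        simp only [if_pos hall, if_pos hA, if_pos hB]
        norm_num
      · simp only [if_neg hall]
        refine mul_nonneg ?_ ?_ <;> split_ifs <;> norm_num
    have h2 := Finset.sum_le_sum (fun F (_ : F ∈ Finset.univ) => key F)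
    rw [hsum, ← Finset.sum_mul] at h2
    have h3 : (∑ F : D → R, if ∀ i ∈ I, E i (F (v i)) (F (u i)) then (1 : ℝ) else 0)
        ≤ (∑ F : D → R, if ∀ j ∈ I.erase i, E j (F (v j)) (F (u j)) then (1 : ℝ) else 0) * p := by
      refine le_of_mul_le_mul_left ?_ hR
      refine h2.trans (le_of_eq ?_)
      ring
    refine h3.trans ?_
    refine (mul_le_mul_of_nonneg_right ih' hp).trans (le_of_eq ?_)
    ring

/-- Existence of a function with few bad points, for a family of tests. -/
lemma exists_good {D Yt O Θ T : Type} [Fintype D] [DecidableEq D] [Fintype Yt] [DecidableEq Yt]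
    [Fintype O] [DecidableEq O] [Nonempty O] [Fintype Θ] [Fintype T]
    (g : Θ → Yt → Yt) (φ : Θ → T → Yt → O → O → ℝ)
    (h1 : ∀ θ t y u w, |φ θ t y u w| ≤ 1) (h0 : ∀ θ t y w, ∑ u, φ θ t y u w = 0)
    (δ : ℝ) (hδ0 : 0 ≤ δ) (hδ2 : δ ≤ 2) (K : ℕ)
    (hsmall : (Fintype.card Θ : ℝ) * 2 * (((Fintype.card D : ℝ) ^ 2 * Fintype.card T)
      * Real.exp (-(δ ^ 2 * Fintype.card Yt / 4))) ^ K < 1) :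
    ∃ F : D → Yt → O, ∀ θ, ∀ B : Finset D,
      (∀ a ∈ B, ∃ a', a' ≠ a ∧ ∃ t, δ * Fintype.card Yt
        < ∑ y, φ θ t y (F a y) (F a' (g θ y))) → B.card ≤ 2 * K := by
  classical
  by_contra hcon
  push Not at hcon
  let e : D → ℤ := fun a => ((Fintype.equivFin D a : ℕ) : ℤ)
  have he : ∀ a b, a ≠ b → e a ≠ e b := by
    intro a b hab h
    apply hab
    have h' : ((Fintype.equivFin D a : ℕ)) = (Fintype.equivFin D b : ℕ) := Int.ofNat.inj h
    exact (Fintype.equivFin D).injective (Fin.ext h')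
  let sg : Bool → ℤ := fun b => if b then 1 else -1
  -- the event
  let Ev : Θ × Bool × (Fin K → D × D × T) → (D → Yt → O) → Prop := fun x F =>
    Function.Injective (fun i => (x.2.2 i).1) ∧
    (∀ i, sg x.2.1 * e (x.2.2 i).1 < sg x.2.1 * e (x.2.2 i).2.1) ∧
    ∀ i ∈ (Finset.univ : Finset (Fin K)), δ * Fintype.card Yt
        < ∑ y, φ x.1 (x.2.2 i).2.2 y (F (x.2.2 i).1 y) (F (x.2.2 i).2.1 (g x.1 y))
  have hcover : ∀ F : D → Yt → O, ∃ x, Ev x F := by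
    intro F
    obtain ⟨θ, B, hB, hcard⟩ := hcon F
    have hsplit := Finset.card_filter_add_card_filter_not (s := B)
      (fun a => ∃ a', e a < e a' ∧ ∃ t, δ * Fintype.card Yt
        < ∑ y, φ θ t y (F a y) (F a' (g θ y)))
    have hex : ∃ b : Bool, ∃ S : Finset D, K ≤ S.card ∧ ∀ a ∈ S,
        ∃ a', sg b * e a < sg b * e a' ∧ ∃ t, δ * Fintype.card Yt
          < ∑ y, φ θ t y (F a y) (F a' (g θ y)) := by
      rcases le_total K (B.filter (fun a => ∃ a', e a < e a' ∧ ∃ t, δ * Fintype.card Yt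
        < ∑ y, φ θ t y (F a y) (F a' (g θ y)))).card with h | h
      · refine ⟨true, _, h, ?_⟩
        intro a ha
        obtain ⟨_, a', h1, h2⟩ := Finset.mem_filter.1 ha
        exact ⟨a', by simpa [sg] using h1, h2⟩
      · refine ⟨false, B.filter (fun a => ¬ ∃ a', e a < e a' ∧ ∃ t, δ * Fintype.card Yt
        < ∑ y, φ θ t y (F a y) (F a' (g θ y))), by omega, ?_⟩
        intro a ha
        obtain ⟨haB, hn⟩ := Finset.mem_filter.1 ha
        obtain ⟨a', hne, ht⟩ := hB a haB
        refine ⟨a', ?_, ht⟩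
        have h1 : ¬ e a < e a' := fun hlt => hn ⟨a', hlt, ht⟩
        have h2 := he a' a hne
        have h3 : e a' < e a := lt_of_le_of_ne (not_lt.1 h1) h2
        simpa [sg] using h3
    obtain ⟨b, S, hS, hSp⟩ := hex
    choose a' ha' t ht using hSp
    obtain ⟨S', hS'S, hS'c⟩ := Finset.exists_subset_card_eq hS
    let eq := (S'.equivFinOfCardEq hS'c).symm
    refine ⟨(θ, b, fun i => ((eq i : D), a' (eq i) (hS'S (eq i).2),
      t (eq i) (hS'S (eq i).2))), ?_, ?_, ?_⟩
    · intro i j hij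
      exact eq.injective (Subtype.ext hij)
    · intro i
      exact ha' _ (hS'S (eq i).2)
    · intro i _
      exact ht _ (hS'S (eq i).2)
  set p := Real.exp (-(δ ^ 2 * Fintype.card Yt / 4)) with hp
  have hcount : ∀ x, (∑ F : D → Yt → O, if Ev x F then (1 : ℝ) else 0)
      ≤ p ^ K * Fintype.card (D → Yt → O) := by
    intro x
    by_cases hx : Function.Injective (fun i => (x.2.2 i).1) ∧
      (∀ i, sg x.2.1 * e (x.2.2 i).1 < sg x.2.1 * e (x.2.2 i).2.1)
    · have := chain_count (D := D) (R := Yt → O) (fun a => sg x.2.1 * e a)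
        (fun i => (x.2.2 i).1) (fun i => (x.2.2 i).2.1) hx.1 hx.2
        (fun i w r => δ * Fintype.card Yt < ∑ y, φ x.1 (x.2.2 i).2.2 y (r y) (w (g x.1 y)))
        p (by
          intro i w
          have := tail_bound (fun y u => φ x.1 (x.2.2 i).2.2 y u (w (g x.1 y)))
            (fun y u => h1 _ _ _ _ _) (fun y => h0 _ _ _ _) δ hδ0 hδ2
          refine le_trans (le_of_eq ?_) this
          refine Finset.sum_congr rfl fun r _ => ?_
          congr) K Finset.univ (by simp)
      refine le_trans (Finset.sum_le_sum fun F _ => ?_) this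
      by_cases hE : Ev x F
      · rw [if_pos hE, if_pos hE.2.2]
      · rw [if_neg hE]
        split_ifs <;> norm_num
    · have : ∀ F, ¬ Ev x F := fun F h => hx ⟨h.1, h.2.1⟩
      simp only [this, if_false, Finset.sum_const_zero]
      positivity
  have htot : (Fintype.card (D → Yt → O) : ℝ)
      ≤ ∑ x, ∑ F : D → Yt → O, if Ev x F then (1 : ℝ) else 0 := by
    rw [Finset.sum_comm, ← Finset.card_univ, Finset.cast_card]
    refine Finset.sum_le_sum fun F _ => ?_
    obtain ⟨x, hx⟩ := hcover F
    refine le_trans (le_of_eq (by rw [if_pos hx])) (Finset.single_le_sum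
      (f := fun x => if Ev x F then (1 : ℝ) else 0)
      (fun y _ => by split_ifs <;> norm_num) (Finset.mem_univ x))
  have hle := htot.trans (Finset.sum_le_sum fun x _ => hcount x)
  have hcardpos : (0 : ℝ) < Fintype.card (D → Yt → O) := by exact_mod_cast Fintype.card_pos
  rw [Finset.sum_const, Finset.card_univ, nsmul_eq_mul] at hle
  have hidx : (Fintype.card (Θ × Bool × (Fin K → D × D × T)) : ℝ)
      = Fintype.card Θ * 2 * ((Fintype.card D : ℝ) ^ 2 * Fintype.card T) ^ K := by
    simp only [Fintype.card_prod, Fintype.card_fun, Fintype.card_bool, Fintype.card_fin]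
    push_cast
    ring
  rw [hidx] at hle
  rw [mul_pow] at hsmall
  nlinarith

/-! ### Averaging part -/

lemma avg_bound {Ω D Yt : Type} [Fintype Ω] [Fintype D] [DecidableEq D] [Fintype Yt]
    [DecidableEq Yt] [Nonempty Yt]
    (μ : Ω → ℝ) (hμ : IsDist μ) (A A' : Ω → D) (Q : Yt × Yt → ℝ) (hQ : ∀ q, 0 ≤ Q q)
    (hQm : ∀ y, ∑ y', Q (y, y') = 1 / Fintype.card Yt)
    (τ η δ : ℝ) (hδ : 0 ≤ δ) (B : ℕ) (hτ0 : 0 ≤ τ)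
    (hτ : ∀ a, (∑ ω, if A ω = a then μ ω else 0) ≤ τ)
    (hη : (∑ ω, if A ω = A' ω then μ ω else 0) ≤ η)
    (H : Ω → Yt → Yt → ℝ) (hH : ∀ ω y y', H ω y y' ≤ 1)
    (hbad : ∀ g : Yt → Yt, ∃ S : Finset D, S.card ≤ B ∧ ∀ ω, A ω ≠ A' ω → A ω ∉ S →
      ∑ y, H ω y (g y) ≤ δ * Fintype.card Yt) :
    ∑ ω, μ ω * ∑ q : Yt × Yt, Q q * H ω q.1 q.2 ≤ δ + τ * B + η := by
  classical
  have hN : (0 : ℝ) < Fintype.card Yt := by exact_mod_cast Fintype.card_pos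
  let Ψ : Yt → Yt → ℝ := fun y y' => ∑ ω, μ ω * H ω y y'
  have hg : ∀ y, ∃ y', ∀ z, Ψ y z ≤ Ψ y y' := by
    intro y
    obtain ⟨y', _, h⟩ := Finset.exists_max_image Finset.univ (Ψ y) Finset.univ_nonempty
    exact ⟨y', fun z => h z (Finset.mem_univ z)⟩
  choose g hg using hg
  have e1 : ∑ ω, μ ω * ∑ q : Yt × Yt, Q q * H ω q.1 q.2 = ∑ y, ∑ y', Q (y, y') * Ψ y y' := by
    simp only [Ψ, Finset.mul_sum]
    rw [Finset.sum_comm, Fintype.sum_prod_type]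
    refine Finset.sum_congr rfl fun y _ => Finset.sum_congr rfl fun y' _ =>
      Finset.sum_congr rfl fun ω _ => ?_
    ring
  have e2 : ∑ y, ∑ y', Q (y, y') * Ψ y y' ≤ ∑ y, (1 / (Fintype.card Yt : ℝ)) * Ψ y (g y) := by
    refine Finset.sum_le_sum fun y _ => ?_
    rw [← hQm y, Finset.sum_mul]
    exact Finset.sum_le_sum fun y' _ => mul_le_mul_of_nonneg_left (hg y y') (hQ _)
  have e3 : ∑ y, (1 / (Fintype.card Yt : ℝ)) * Ψ y (g y)
      = ∑ ω, μ ω * ((1 / (Fintype.card Yt : ℝ)) * ∑ y, H ω y (g y)) := by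
    simp only [Ψ, Finset.mul_sum]
    rw [Finset.sum_comm]
    refine Finset.sum_congr rfl fun y _ => Finset.sum_congr rfl fun ω _ => ?_
    ring
  rw [e1]
  refine e2.trans ?_
  rw [e3]
  obtain ⟨S, hSc, hS⟩ := hbad g
  have e4 : ∀ ω, μ ω * ((1 / (Fintype.card Yt : ℝ)) * ∑ y, H ω y (g y))
      ≤ δ * μ ω + (∑ a ∈ S, if A ω = a then μ ω else 0) + (if A ω = A' ω then μ ω else 0) := by
    intro ω
    have hm := hμ.1 ω
    have hle1 : (1 / (Fintype.card Yt : ℝ)) * ∑ y, H ω y (g y) ≤ 1 := by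
      have : ∑ y, H ω y (g y) ≤ ∑ _y : Yt, (1 : ℝ) := Finset.sum_le_sum fun y _ => hH _ _ _
      simp at this
      rw [one_div, inv_mul_le_iff₀ hN]
      linarith
    have hs0 : 0 ≤ ∑ a ∈ S, if A ω = a then μ ω else 0 :=
      Finset.sum_nonneg fun a _ => by split_ifs <;> linarith
    have hd0 : 0 ≤ (if A ω = A' ω then μ ω else 0) := by split_ifs <;> linarith
    have hdm : 0 ≤ δ * μ ω := mul_nonneg hδ hm
    by_cases hA : A ω = A' ω
    · rw [if_pos hA]
      nlinarith
    · by_cases hAS : A ω ∈ S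
      · rw [Finset.sum_ite_eq, if_pos hAS]
        nlinarith
      · have := hS ω hA hAS
        have h2 : (1 / (Fintype.card Yt : ℝ)) * ∑ y, H ω y (g y) ≤ δ := by
          rw [one_div, inv_mul_le_iff₀ hN]
          linarith
        nlinarith
  refine (Finset.sum_le_sum fun ω _ => e4 ω).trans ?_
  rw [Finset.sum_add_distrib, Finset.sum_add_distrib, ← Finset.mul_sum, hμ.2, Finset.sum_comm]
  have e5 : ∑ a ∈ S, ∑ ω, (if A ω = a then μ ω else 0) ≤ τ * B := by
    refine (Finset.sum_le_sum fun a _ => hτ a).trans ?_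
    rw [Finset.sum_const, nsmul_eq_mul, mul_comm]
    exact mul_le_mul_of_nonneg_left (by exact_mod_cast hSc) hτ0
  linarith

/-! ### Distribution bookkeeping -/

lemma distMap_sum {α β : Type*} [Fintype α] [Fintype β] [DecidableEq β] (f : α → β) (p : α → ℝ)
    (h : β → ℝ) : ∑ b, distMap f p b * h b = ∑ a, p a * h (f a) := by
  simp only [distMap, Finset.sum_mul]
  rw [Finset.sum_comm]
  refine Finset.sum_congr rfl fun a _ => ?_
  simp [ite_mul]

lemma distMap_nonneg {α β : Type*} [Fintype α] [DecidableEq β] (f : α → β) (p : α → ℝ)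
    (hp : ∀ a, 0 ≤ p a) (b : β) : 0 ≤ distMap f p b :=
  Finset.sum_nonneg fun a _ => by split_ifs <;> simp [hp]

lemma distMap_isDist {α β : Type*} [Fintype α] [Fintype β] [DecidableEq β] (f : α → β)
    (p : α → ℝ) (hp : IsDist p) : IsDist (distMap f p) := by
  refine ⟨distMap_nonneg f p hp.1, ?_⟩
  have := distMap_sum f p (fun _ => 1)
  simp only [mul_one] at this
  rw [this, hp.2]

lemma unif_isDist (α : Type*) [Fintype α] [Nonempty α] : IsDist (unifDist α) := by
  refine ⟨fun a => by unfold unifDist; positivity, ?_⟩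
  have : (Fintype.card α : ℝ) ≠ 0 := by exact_mod_cast Fintype.card_ne_zero
  simp [unifDist, this]

lemma prod_isDist {α β : Type*} [Fintype α] [Fintype β] (p : α → ℝ) (q : β → ℝ)
    (hp : IsDist p) (hq : IsDist q) : IsDist (prodDist p q) := by
  refine ⟨fun x => mul_nonneg (hp.1 _) (hq.1 _), ?_⟩
  simp only [prodDist]
  rw [Fintype.sum_prod_type]
  simp [← Finset.mul_sum, hq.2, hp.2]

lemma sd_le_one {α : Type*} [Fintype α] (p q : α → ℝ) (hp : IsDist p) (hq : IsDist q) :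
    sd p q ≤ 1 := by
  unfold sd
  have : ∑ a, |p a - q a| ≤ ∑ a, (p a + q a) := by
    refine Finset.sum_le_sum fun a _ => ?_
    rw [abs_le]
    have := hp.1 a
    have := hq.1 a
    constructor <;> linarith
  rw [Finset.sum_add_distrib, hp.2, hq.2] at this
  linarith

/-- sign of a boolean -/
def sgn (b : Bool) : ℝ := if b then 1 else -1

/-- centred test -/
def cen {O : Type} [Fintype O] (t : O → O → Bool) (u w : O) : ℝ :=
  (sgn (t u w) - (1 / (Fintype.card O : ℝ)) * ∑ u', sgn (t u' w)) / 2

lemma sgn_abs (b : Bool) : |sgn b| = 1 := by cases b <;> simp [sgn]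

lemma cen_abs {O : Type} [Fintype O] [Nonempty O] (t : O → O → Bool) (u w : O) :
    |cen t u w| ≤ 1 := by
  have hN : (0 : ℝ) < Fintype.card O := by exact_mod_cast Fintype.card_pos
  have h1 : |∑ u', sgn (t u' w)| ≤ Fintype.card O := by
    refine (Finset.abs_sum_le_sum_abs _ _).trans ?_
    simp [sgn_abs]
  have h2 : |(1 / (Fintype.card O : ℝ)) * ∑ u', sgn (t u' w)| ≤ 1 := by
    rw [abs_mul, abs_of_pos (by positivity), one_div, inv_mul_le_iff₀ hN]
    linarith
  have h3 := sgn_abs (t u w)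
  unfold cen
  rw [abs_div, abs_two]
  have := abs_sub (sgn (t u w)) ((1 / (Fintype.card O : ℝ)) * ∑ u', sgn (t u' w))
  linarith

lemma cen_sum {O : Type} [Fintype O] [Nonempty O] (t : O → O → Bool) (w : O) :
    ∑ u, cen t u w = 0 := by
  have hN : (Fintype.card O : ℝ) ≠ 0 := by exact_mod_cast Fintype.card_ne_zero
  unfold cen
  rw [← Finset.sum_div, Finset.sum_sub_distrib, Finset.sum_const, Finset.card_univ, nsmul_eq_mul]
  field_simp
  simp

/-- The statistical distance as the expectation of a centred test. -/
lemma sd_eq_test {Ω O S : Type} [Fintype Ω] [Fintype O] [DecidableEq O] [Fintype S]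
    [DecidableEq S] [Nonempty O] (μ : Ω → ℝ) (W W' : Ω → O) (Z : Ω → S) :
    ∃ s : S → O → O → Bool,
      sd (distMap (fun ω => (W ω, W' ω, Z ω)) μ)
        (distMap (fun p : O × Ω => (p.1, W' p.2, Z p.2)) (prodDist (unifDist O) μ))
      = ∑ ω, μ ω * cen (s (Z ω)) (W ω) (W' ω) := by
  classical
  set P := distMap (fun ω => (W ω, W' ω, Z ω)) μ with hP
  set Q := distMap (fun p : O × Ω => (p.1, W' p.2, Z p.2)) (prodDist (unifDist O) μ) with hQ
  refine ⟨fun z u w => decide (0 ≤ P (u, w, z) - Q (u, w, z)), ?_⟩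
  set s : S → O → O → Bool := fun z u w => decide (0 ≤ P (u, w, z) - Q (u, w, z)) with hs
  have h1 : ∀ x : O × O × S, |P x - Q x| = P x * sgn (s x.2.2 x.1 x.2.1)
      - Q x * sgn (s x.2.2 x.1 x.2.1) := by
    rintro ⟨u, w, z⟩
    simp only [hs, sgn, decide_eq_true_eq]
    split_ifs with h
    · rw [abs_of_nonneg h]; ring
    · rw [abs_of_neg (not_le.1 h)]; ring
  unfold sd
  rw [Finset.sum_congr rfl fun x _ => h1 x, Finset.sum_sub_distrib]
  rw [hP, hQ, distMap_sum, distMap_sum, Fintype.sum_prod_type_right]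
  rw [← Finset.sum_sub_distrib, Finset.sum_div]
  refine Finset.sum_congr rfl fun ω _ => ?_
  simp only [cen, prodDist, unifDist, Finset.mul_sum]
  rw [mul_div_assoc', mul_sub, Finset.mul_sum]
  congr 2
  refine Finset.sum_congr rfl fun u _ => ?_
  ring

lemma indep_sum {Ω α β : Type} [Fintype Ω] [Fintype α] [Fintype β] [DecidableEq α]
    [DecidableEq β] (μ : Ω → ℝ) (Z : Ω → α) (Q : Ω → β)
    (h : distMap (fun ω => (Z ω, Q ω)) μ = prodDist (distMap Z μ) (distMap Q μ))
    (H : α → β → ℝ) :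
    ∑ ω, μ ω * H (Z ω) (Q ω) = ∑ ω, μ ω * ∑ q, distMap Q μ q * H (Z ω) q := by
  have e1 := distMap_sum (fun ω => (Z ω, Q ω)) μ (fun x => H x.1 x.2)
  have e2 := distMap_sum Z μ (fun z => ∑ q, distMap Q μ q * H z q)
  simp only at e1 e2
  rw [← e1, ← e2, h, Fintype.sum_prod_type]
  refine Finset.sum_congr rfl fun z _ => ?_
  rw [Finset.mul_sum]
  refine Finset.sum_congr rfl fun q _ => ?_
  simp only [prodDist]
  ring

lemma marg_unif {Ω β : Type} [Fintype Ω] [Fintype β] [DecidableEq β] (μ : Ω → ℝ) (Y Y' : Ω → β)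
    (h : distMap Y μ = unifDist β) (y : β) :
    ∑ y', distMap (fun ω => (Y ω, Y' ω)) μ (y, y') = 1 / Fintype.card β := by
  have := congrFun h y
  simp only [unifDist] at this
  rw [← this]
  simp only [distMap]
  rw [Finset.sum_comm]
  refine Finset.sum_congr rfl fun ω _ => ?_
  by_cases hy : Y ω = y <;> simp [hy]

lemma marg_X {Ω α β : Type} [Fintype Ω] [Fintype α] [Fintype β] [DecidableEq α] [DecidableEq β]
    (μ : Ω → ℝ) (hμ : IsDist μ) (Z : Ω → α) (X : Ω → β)
    (h : distMap (fun ω => (Z ω, X ω)) μ = prodDist (distMap Z μ) (unifDist β)) (x : β) :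
    (∑ ω, if X ω = x then μ ω else 0) = 1 / Fintype.card β := by
  have e1 := distMap_sum (fun ω => (Z ω, X ω)) μ (fun b => if b.2 = x then 1 else 0)
  have e2 : (∑ ω, if X ω = x then μ ω else 0) = ∑ ω, μ ω * (if X ω = x then 1 else 0) := by
    refine Finset.sum_congr rfl fun ω _ => ?_
    split_ifs <;> simp
  rw [e2, ← e1, h, Fintype.sum_prod_type]
  simp only [prodDist, unifDist, mul_ite, mul_one, mul_zero, Finset.sum_ite_eq', Finset.mem_univ,
    if_true]
  rw [← Finset.sum_mul, (distMap_isDist Z μ hμ).2, one_mul]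

lemma diag_bound {Ω β : Type} [Fintype Ω] [Fintype β] [DecidableEq β]
    (μ : Ω → ℝ) (hμ : IsDist μ) (V V' : Ω → β)
    (h : distMap (fun ω => (V ω, V' ω)) μ = prodDist (unifDist β) (distMap V' μ)) :
    (∑ ω, if V ω = V' ω then μ ω else 0) = 1 / Fintype.card β := by
  have e1 := distMap_sum (fun ω => (V ω, V' ω)) μ (fun b => if b.1 = b.2 then 1 else 0)
  have e2 : (∑ ω, if V ω = V' ω then μ ω else 0)
      = ∑ ω, μ ω * (if V ω = V' ω then 1 else 0) := by
    refine Finset.sum_congr rfl fun ω _ => ?_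
    split_ifs <;> simp
  rw [e2, ← e1, h, Fintype.sum_prod_type_right]
  simp only [prodDist, unifDist, mul_ite, mul_one, mul_zero, Finset.sum_ite_eq', Finset.mem_univ,
    if_true]
  rw [← Finset.mul_sum, (distMap_isDist V' μ hμ).2, mul_one]

/-! ### From good functions to mergers -/

lemma nipm_core {L m d1 d2 m1 : ℕ} (ε : ℝ) (hε : 0 ≤ ε) (K : ℕ)
    (hK : (2 * K : ℝ) ≤ ε * 2 ^ d1) (hm : 1 / (2 : ℝ) ^ m ≤ ε)
    (F : (Fin L → BS m) × BS d1 → BS d2 → BS m1)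
    (Ω : Type) [Fintype Ω] (μ : Ω → ℝ) (hμ : IsDist μ)
    (V V' : Ω → Fin L → BS m) (X X' : Ω → BS d1) (Y Y' : Ω → BS d2)
    (hh : ∃ h : Fin L, distMap (fun ω => (V ω h, V' ω h)) μ
          = prodDist (unifDist (BS m)) (distMap (fun ω => V' ω h) μ))
    (hX : distMap (fun ω => ((V ω, V' ω), X ω)) μ
          = prodDist (distMap (fun ω => (V ω, V' ω)) μ) (unifDist (BS d1)))
    (hY : distMap Y μ = unifDist (BS d2))
    (hI : distMap (fun ω => ((V ω, V' ω, X ω, X' ω), (Y ω, Y' ω))) μ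
          = prodDist (distMap (fun ω => (V ω, V' ω, X ω, X' ω)) μ)
              (distMap (fun ω => (Y ω, Y' ω)) μ))
    (s : BS d1 → BS d1 → BS d2 → BS d2 → BS m1 → BS m1 → Bool)
    (hbad : ∀ g : BS d2 → BS d2, ∃ S : Finset ((Fin L → BS m) × BS d1), S.card ≤ 2 * K ∧
      ∀ a a' : (Fin L → BS m) × BS d1, a ≠ a' → a ∉ S →
        ∑ y, cen (s a.2 a'.2 y (g y)) (F a y) (F a' (g y)) ≤ ε * Fintype.card (BS d2)) :
    ∑ ω, μ ω * cen (s (X ω) (X' ω) (Y ω) (Y' ω)) (F (V ω, X ω) (Y ω)) (F (V' ω, X' ω) (Y' ω))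
      ≤ 3 * ε := by
  classical
  have e1 := indep_sum μ (fun ω => (V ω, V' ω, X ω, X' ω)) (fun ω => (Y ω, Y' ω)) hI
    (fun z q => cen (s z.2.2.1 z.2.2.2 q.1 q.2) (F (z.1, z.2.2.1) q.1) (F (z.2.1, z.2.2.2) q.2))
  simp only at e1
  rw [e1]
  have hcard : ∀ n : ℕ, (Fintype.card (BS n) : ℝ) = 2 ^ n := by intro n; simp
  obtain ⟨h, hh⟩ := hh
  have := avg_bound μ hμ (fun ω => (V ω, X ω)) (fun ω => (V' ω, X' ω))
    (distMap (fun ω => (Y ω, Y' ω)) μ) (distMap_nonneg _ _ hμ.1) (marg_unif μ Y Y' hY)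
    (1 / 2 ^ d1) ε ε hε (2 * K) (by positivity)
    (by
      rintro ⟨v, x⟩
      have := marg_X μ hμ (fun ω => (V ω, V' ω)) X hX x
      rw [hcard] at this
      rw [← this]
      refine Finset.sum_le_sum fun ω _ => ?_
      have h0 := hμ.1 ω
      by_cases h1 : X ω = x
      · rw [if_pos h1]; split_ifs <;> linarith
      · rw [if_neg h1, if_neg (by simp [h1])])
    (by
      have := diag_bound μ hμ (fun ω => V ω h) (fun ω => V' ω h) hh
      rw [hcard] at this
      refine le_trans ?_ hm
      rw [← this]
      refine Finset.sum_le_sum fun ω _ => ?_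
      have h0 := hμ.1 ω
      by_cases h1 : V ω h = V' ω h
      · rw [if_pos h1]; split_ifs <;> linarith
      · rw [if_neg h1, if_neg (by
          intro hc
          exact h1 (congrFun (congrArg Prod.fst hc) h))])
    (fun ω y y' => cen (s (X ω) (X' ω) y y') (F (V ω, X ω) y) (F (V' ω, X' ω) y'))
    (fun ω y y' => (le_abs_self _).trans (cen_abs _ _ _))
    (by
      intro g
      obtain ⟨S, hS, hS2⟩ := hbad g
      exact ⟨S, hS, fun ω h1 h2 => hS2 _ _ h1 h2⟩)
  refine this.trans ?_
  have hp : (0 : ℝ) < 2 ^ d1 := by positivity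
  have : 1 / (2 : ℝ) ^ d1 * ((2 * K : ℕ) : ℝ) ≤ ε := by
    push_cast
    rw [one_div, inv_mul_le_iff₀ hp]
    linarith
  linarith

lemma fx_strong {L m d1 d2 m1 : ℕ} (ε : ℝ) (hε : 0 ≤ ε) (K : ℕ)
    (hK : (2 * K : ℝ) ≤ ε * 2 ^ d1) (hm : 1 / (2 : ℝ) ^ m ≤ ε)
    (F : (Fin L → BS m) × BS d1 → BS d2 → BS m1)
    (hF : ∀ θ : (BS d2 → BS d2) × (BS d2 → BS m1 → BS m1 → Bool),
      ∀ B : Finset ((Fin L → BS m) × BS d1),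
      (∀ a ∈ B, ∃ a', a' ≠ a ∧ ∃ _t : Unit, ε * Fintype.card (BS d2)
        < ∑ y, cen (θ.2 y) (F a y) (F a' (θ.1 y))) → B.card ≤ 2 * K) :
    IsNIPMStrongY (fun v x y => F (v, x) y) (3 * ε) := by
  classical
  intro Ω _ μ hμ V V' X X' Y Y' _ hh hX hY hI
  obtain ⟨s, hs⟩ := sd_eq_test μ (fun ω => F (V ω, X ω) (Y ω)) (fun ω => F (V' ω, X' ω) (Y' ω))
    (fun ω => (Y ω, Y' ω))
  rw [hs]
  refine nipm_core ε hε K hK hm F Ω μ hμ V V' X X' Y Y' hh hX hY hI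
    (fun _ _ y y' => s (y, y')) ?_
  intro g
  refine ⟨Finset.univ.filter fun a => ∃ a', a' ≠ a ∧ ∃ _t : Unit, ε * Fintype.card (BS d2)
        < ∑ y, cen (s (y, g y)) (F a y) (F a' (g y)), ?_, ?_⟩
  · exact hF (g, fun y => s (y, g y)) _ (fun a ha => (Finset.mem_filter.1 ha).2)
  · intro a a' hne ha
    by_contra hc
    exact ha (Finset.mem_filter.2 ⟨Finset.mem_univ _, a', hne.symm, (), not_le.1 hc⟩)

lemma fy_strong {L m d1 d2 m1 : ℕ} (ε : ℝ) (hε : 0 ≤ ε) (K : ℕ)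
    (hK : (2 * K : ℝ) ≤ ε * 2 ^ d1) (hm : 1 / (2 : ℝ) ^ m ≤ ε)
    (F : (Fin L → BS m) × BS d1 → BS d2 → BS m1)
    (hF : ∀ θ : (BS d2 → BS d2),
      ∀ B : Finset ((Fin L → BS m) × BS d1),
      (∀ a ∈ B, ∃ a', a' ≠ a ∧ ∃ t : BS m1 → BS m1 → Bool, ε * Fintype.card (BS d2)
        < ∑ y, cen t (F a y) (F a' (θ y))) → B.card ≤ 2 * K) :
    IsNIPMStrongX (fun v x y => F (v, x) y) (3 * ε) := by
  classical
  intro Ω _ μ hμ V V' X X' Y Y' _ hh hX hY hI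
  obtain ⟨s, hs⟩ := sd_eq_test μ (fun ω => F (V ω, X ω) (Y ω)) (fun ω => F (V' ω, X' ω) (Y' ω))
    (fun ω => (X ω, X' ω))
  rw [hs]
  refine nipm_core ε hε K hK hm F Ω μ hμ V V' X X' Y Y' hh hX hY hI
    (fun x x' _ _ => s (x, x')) ?_
  intro g
  refine ⟨Finset.univ.filter fun a => ∃ a', a' ≠ a ∧ ∃ t : BS m1 → BS m1 → Bool,
    ε * Fintype.card (BS d2) < ∑ y, cen t (F a y) (F a' (g y)), ?_, ?_⟩
  · exact hF g _ (fun a ha => (Finset.mem_filter.1 ha).2)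
  · intro a a' hne ha
    by_contra hc
    exact ha (Finset.mem_filter.2 ⟨Finset.mem_univ _, a', hne.symm, s (a.2, a'.2), not_le.1 hc⟩)

/-! ### Numerics -/

lemma two_pow_le_exp (n : ℕ) : (2 : ℝ) ^ n ≤ Real.exp n := by
  have h : (2 : ℝ) ≤ Real.exp 1 := by
    have := Real.add_one_le_exp (1 : ℝ)
    linarith
  calc (2 : ℝ) ^ n ≤ (Real.exp 1) ^ n := pow_le_pow_left₀ (by norm_num) h n
    _ = Real.exp n := by rw [← Real.exp_nat_mul]; simp

lemma small_aux (cΘ cD cT N δ a b : ℝ) (K : ℕ) (h1 : 0 ≤ cΘ) (h2 : 0 ≤ cD) (h3 : 0 ≤ cT)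
    (hN : 1 ≤ N) (hΘ : cΘ ≤ Real.exp (N * a)) (hD : cD ^ 2 * cT ≤ Real.exp b)
    (hb : b ≤ δ ^ 2 * N / 8) (hK : a + 1 < K * (δ ^ 2 / 8)) :
    cΘ * 2 * ((cD ^ 2 * cT) * Real.exp (-(δ ^ 2 * N / 4))) ^ K < 1 := by
  have e1 : (cD ^ 2 * cT) * Real.exp (-(δ ^ 2 * N / 4)) ≤ Real.exp (-(δ ^ 2 * N / 8)) := by
    calc _ ≤ Real.exp b * Real.exp (-(δ ^ 2 * N / 4)) :=
          mul_le_mul_of_nonneg_right hD (Real.exp_pos _).le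
      _ = Real.exp (b + -(δ ^ 2 * N / 4)) := (Real.exp_add _ _).symm
      _ ≤ _ := Real.exp_le_exp.2 (by linarith)
  have e2 := pow_le_pow_left₀ (by positivity) e1 K
  rw [← Real.exp_nat_mul] at e2
  have h : (2 : ℝ) ≤ Real.exp 1 := by
    have := Real.add_one_le_exp (1 : ℝ)
    linarith
  calc _ ≤ (Real.exp (N * a) * Real.exp 1) * Real.exp (K * -(δ ^ 2 * N / 8)) := by
        refine mul_le_mul (mul_le_mul hΘ h (by norm_num) (Real.exp_pos _).le) e2
          (by positivity) (by positivity)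
    _ = Real.exp (N * a + 1 + K * -(δ ^ 2 * N / 8)) := by rw [← Real.exp_add, ← Real.exp_add]
    _ < 1 := by
        rw [Real.exp_lt_one_iff]
        nlinarith

/-- All numeric facts that are needed. -/
lemma numerics (ε M D : ℝ) (d L m d1 d2 : ℕ) (hε : 0 < ε) (hL1 : 1 ≤ L) (hLε : 3 * L * ε < 1)
    (hM1 : 1 ≤ M) (hd1M : (d1 : ℝ) ≤ M) (hd2M : (d2 : ℝ) ≤ M) (hD : D = 2 ^ d)
    (hDq : (M / ε) ^ 2 ≤ D) (hm : d ≤ m) (hd1 : 8 * d + 6 * m ≤ d1) (hd2 : 9 * d ≤ d2) :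
    1 / (2 : ℝ) ^ m ≤ ε ∧
    ((2 * (L * m + d1) : ℕ) : ℝ) + (2 : ℝ) ^ (2 * d) ≤ ε ^ 2 * 2 ^ d2 / 8 ∧
    ∃ K : ℕ, (2 * K : ℝ) ≤ ε * 2 ^ d1 ∧
      ((d2 : ℝ) + 2 ^ (2 * m)) + 1 < K * (ε ^ 2 / 8) := by
  set q := M / ε with hq
  have hL1' : (1 : ℝ) ≤ L := by exact_mod_cast hL1
  have hε1 : ε < 1 / 3 := by nlinarith
  have hqM : q * ε = M := by rw [hq]; field_simp
  have hq0 : 0 < q := by positivity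
  have hqM' : 3 * M ≤ q := by nlinarith
  have hqe : 1 ≤ q * ε := by linarith
  have hq3 : 3 ≤ q := by linarith
  have hD9 : 9 ≤ D := by nlinarith
  have hqD : 3 * q ≤ D := by nlinarith
  have hDε : 1 ≤ D * ε ^ 2 := by nlinarith
  have hDε1 : 1 ≤ D * ε := by nlinarith
  have hE : (1 : ℝ) ≤ 2 ^ (2 * m) := one_le_pow₀ (by norm_num)
  have hm2 : D ≤ 2 ^ m := by
    rw [hD]; exact pow_le_pow_right₀ (by norm_num) hm
  have h2d : (2 : ℝ) ^ (2 * d) = D ^ 2 := by rw [hD, ← pow_mul, mul_comm]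
  have hN : D ^ 9 ≤ 2 ^ d2 := by
    rw [hD, ← pow_mul]; exact pow_le_pow_right₀ (by norm_num) (by omega)
  have hX : (2 : ℝ) ^ (2 * m) * D ^ 8 ≤ 2 ^ d1 := by
    rw [hD, ← pow_mul, ← pow_add]; exact pow_le_pow_right₀ (by norm_num) (by omega)
  refine ⟨?_, ?_, ?_⟩
  · rw [div_le_iff₀ (by positivity)]
    nlinarith
  · rw [h2d]
    have hn : ((2 * (L * m + d1) : ℕ) : ℝ) ≤ 2 * q := by
      push_cast
      have hmM : (m : ℝ) ≤ M := by
        have : m ≤ d1 := by omega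
        have : (m : ℝ) ≤ d1 := by exact_mod_cast this
        linarith
      have h1 : (L : ℝ) * m ≤ L * M := by nlinarith
      have h2 : 3 * ((L : ℝ) * M) ≤ q := by
        have : 3 * (L : ℝ) * (q * ε) ≤ q := by nlinarith
        rw [hqM] at this
        linarith
      linarith
    have h3 : D ^ 8 ≤ ε ^ 2 * D ^ 9 := by
      have : (0 : ℝ) ≤ D ^ 8 := by positivity
      nlinarith
    have h4 : ε ^ 2 * D ^ 9 ≤ ε ^ 2 * 2 ^ d2 := mul_le_mul_of_nonneg_left hN (by positivity)
    have h5 : D ^ 2 * 9 ^ 6 ≤ D ^ 8 := by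
      have h6 : (9 : ℝ) ^ 6 ≤ D ^ 6 := pow_le_pow_left₀ (by norm_num) hD9 6
      have : D ^ 8 = D ^ 2 * D ^ 6 := by ring
      rw [this]
      exact mul_le_mul_of_nonneg_left h6 (by positivity)
    nlinarith
  · set E : ℝ := 2 ^ (2 * m) with hEdef
    refine ⟨⌊ε * 2 ^ d1 / 2⌋₊, ?_, ?_⟩
    · have := Nat.floor_le (a := ε * 2 ^ d1 / 2) (by positivity)
      linarith
    · have hfl := Nat.lt_floor_add_one (ε * 2 ^ d1 / 2)
      have hεX : ε * (E * D ^ 8) ≤ ε * 2 ^ d1 := mul_le_mul_of_nonneg_left hX hε.le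
      have h7 : E * D ^ 7 ≤ ε * (E * D ^ 8) := by
        have : (0 : ℝ) ≤ E * D ^ 7 := by positivity
        have h8 : ε * (E * D ^ 8) = (E * D ^ 7) * (D * ε) := by ring
        rw [h8]
        nlinarith
      have hK : E * D ^ 7 / 2 - 1 ≤ (⌊ε * 2 ^ d1 / 2⌋₊ : ℝ) := by linarith
      have hED : 9 ^ 7 ≤ E * D ^ 7 := by
        have h6 : (9 : ℝ) ^ 7 ≤ D ^ 7 := pow_le_pow_left₀ (by norm_num) hD9 7
        nlinarith
      have hK4 : E * D ^ 7 / 4 ≤ (⌊ε * 2 ^ d1 / 2⌋₊ : ℝ) := by linarith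
      have h9 : E * D ^ 7 / 4 * (ε ^ 2 / 8) ≤ (⌊ε * 2 ^ d1 / 2⌋₊ : ℝ) * (ε ^ 2 / 8) :=
        mul_le_mul_of_nonneg_right hK4 (by positivity)
      have h10 : E * D ^ 6 / 32 ≤ E * D ^ 7 / 4 * (ε ^ 2 / 8) := by
        have : (0 : ℝ) ≤ E * D ^ 6 := by positivity
        have h8 : E * D ^ 7 / 4 * (ε ^ 2 / 8) = (E * D ^ 6) * (D * ε ^ 2) / 32 := by ring
        rw [h8]
        nlinarith
      have h11 : D * 9 ^ 5 ≤ D ^ 6 := by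
        have h6 : (9 : ℝ) ^ 5 ≤ D ^ 5 := pow_le_pow_left₀ (by norm_num) hD9 5
        have : D ^ 6 = D * D ^ 5 := by ring
        rw [this]
        exact mul_le_mul_of_nonneg_left h6 (by positivity)
      have h12 : E * (D * 9 ^ 5) ≤ E * D ^ 6 := mul_le_mul_of_nonneg_left h11 (by positivity)
      have h13 : D ≤ E * D := by nlinarith
      have h14 : E * 9 ≤ E * D := by nlinarith
      linarith

lemma card_fun_exp (d2 : ℕ) (n : ℕ) :
    ((Fintype.card (BS d2 → BS d2) : ℝ)) * 2 ^ ((2 ^ n) * 2 ^ d2)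
      ≤ Real.exp (2 ^ d2 * ((d2 : ℝ) + 2 ^ n)) := by
  have : ((Fintype.card (BS d2 → BS d2) : ℝ)) * 2 ^ ((2 ^ n) * 2 ^ d2)
      = 2 ^ (2 ^ d2 * (d2 + 2 ^ n)) := by
    simp only [Fintype.card_fun, Fintype.card_bool, Fintype.card_fin]
    push_cast
    rw [← pow_mul, ← pow_add]
    congr 1
    ring
  rw [this]
  refine (two_pow_le_exp _).trans (le_of_eq ?_)
  push_cast
  rfl

lemma trivial_Y {L m d1 d2 m1 : ℕ} (F : (Fin L → BS m) → BS d1 → BS d2 → BS m1) (ε : ℝ)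
    (h : 1 ≤ ε) : IsNIPMStrongY F ε := by
  intro Ω _ μ hμ V V' X X' Y Y' _ _ _ _ _
  exact (sd_le_one _ _ (distMap_isDist _ _ hμ)
    (distMap_isDist _ _ (prod_isDist _ _ (unif_isDist _) hμ))).trans h

lemma trivial_X {L m d1 d2 m1 : ℕ} (F : (Fin L → BS m) → BS d1 → BS d2 → BS m1) (ε : ℝ)
    (h : 1 ≤ ε) : IsNIPMStrongX F ε := by
  intro Ω _ μ hμ V V' X X' Y Y' _ _ _ _ _
  exact (sd_le_one _ _ (distMap_isDist _ _ hμ)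
    (distMap_isDist _ _ (prod_isDist _ _ (unif_isDist _) hμ))).trans h

lemma mono_Y {L m d1 d2 m1 : ℕ} (F : (Fin L → BS m) → BS d1 → BS d2 → BS m1) (ε ε' : ℝ)
    (h : ε ≤ ε') (hF : IsNIPMStrongY F ε) : IsNIPMStrongY F ε' := by
  intro Ω _ μ hμ V V' X X' Y Y' h1 h2 h3 h4 h5
  exact (hF Ω μ hμ V V' X X' Y Y' h1 h2 h3 h4 h5).trans h

lemma mono_X {L m d1 d2 m1 : ℕ} (F : (Fin L → BS m) → BS d1 → BS d2 → BS m1) (ε ε' : ℝ)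
    (h : ε ≤ ε') (hF : IsNIPMStrongX F ε) : IsNIPMStrongX F ε' := by
  intro Ω _ μ hμ V V' X X' Y Y' h1 h2 h3 h4 h5
  exact (hF Ω μ hμ V V' X X' Y Y' h1 h2 h3 h4 h5).trans h

lemma main_exists (ε M : ℝ) (d L m d1 d2 : ℕ) (hε : 0 < ε) (hL1 : 1 ≤ L) (hLε : 3 * L * ε < 1)
    (hM1 : 1 ≤ M) (hd1M : (d1 : ℝ) ≤ M) (hd2M : (d2 : ℝ) ≤ M)
    (hDq : (M / ε) ^ 2 ≤ 2 ^ d) (hm : d ≤ m) (hd1 : 8 * d + 6 * m ≤ d1) (hd2 : 9 * d ≤ d2) :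
    ∃ (Fx : (Fin L → BS m) → BS d1 → BS d2 → BS m) (Fy : (Fin L → BS m) → BS d1 → BS d2 → BS d),
      IsNIPMStrongY Fx (3 * ε) ∧ IsNIPMStrongX Fy (3 * ε) := by
  classical
  obtain ⟨hme, hb, K, hK, hK2⟩ := numerics ε M _ d L m d1 d2 hε hL1 hLε hM1 hd1M hd2M rfl hDq hm
    hd1 hd2
  have hL1' : (1 : ℝ) ≤ L := by exact_mod_cast hL1
  have hε2 : ε ≤ 2 := by nlinarith
  have hcY : (Fintype.card (BS d2) : ℝ) = 2 ^ d2 := by simp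
  have hcD : (Fintype.card ((Fin L → BS m) × BS d1) : ℝ) = 2 ^ (L * m + d1) := by
    simp only [Fintype.card_prod, Fintype.card_fun, Fintype.card_bool, Fintype.card_fin]
    push_cast
    rw [← pow_mul, ← pow_add, mul_comm m L]
  have hN1 : (1 : ℝ) ≤ 2 ^ d2 := one_le_pow₀ (by norm_num)
  have hDexp : ((2 : ℝ) ^ (L * m + d1)) ^ 2 * 2 ^ (2 ^ (2 * d))
      ≤ Real.exp (((2 * (L * m + d1) : ℕ) : ℝ) + (2 : ℝ) ^ (2 * d)) := by
    rw [← pow_mul, ← pow_add]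
    refine (two_pow_le_exp _).trans (le_of_eq ?_)
    congr 1
    push_cast
    ring
  obtain ⟨Fx, hFx⟩ := exists_good (D := (Fin L → BS m) × BS d1) (Yt := BS d2) (O := BS m)
    (Θ := (BS d2 → BS d2) × (BS d2 → BS m → BS m → Bool)) (T := Unit)
    (fun θ => θ.1) (fun θ _ y u w => cen (θ.2 y) u w)
    (fun _ _ _ _ _ => cen_abs _ _ _) (fun _ _ _ _ => cen_sum _ _) ε hε.le hε2 K (by
      rw [hcY, hcD]
      refine small_aux _ _ _ _ _ _ _ K (by positivity) (by positivity) (by positivity) hN1 ?_ ?_ hb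
        hK2
      · refine le_trans (le_of_eq ?_) (card_fun_exp d2 (2 * m))
        rw [Fintype.card_prod]
        push_cast
        congr 1
        simp only [Fintype.card_fun, Fintype.card_bool, Fintype.card_fin]
        push_cast
        rw [← pow_mul, ← pow_mul]
        congr 1
        ring
      · refine le_trans ?_ hDexp
        refine mul_le_mul_of_nonneg_left ?_ (by positivity)
        simp only [Fintype.card_unit, Nat.cast_one]
        exact one_le_pow₀ (by norm_num))
  obtain ⟨Fy, hFy⟩ := exists_good (D := (Fin L → BS m) × BS d1) (Yt := BS d2) (O := BS d)
    (Θ := (BS d2 → BS d2)) (T := BS d → BS d → Bool)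
    (fun θ => θ) (fun _ t _ u w => cen t u w)
    (fun _ _ _ _ _ => cen_abs _ _ _) (fun _ _ _ _ => cen_sum _ _) ε hε.le hε2 K (by
      rw [hcY, hcD]
      refine small_aux _ _ _ _ _ _ _ K (by positivity) (by positivity) (by positivity) hN1 ?_ ?_ hb
        hK2
      · refine le_trans ?_ (card_fun_exp d2 (2 * m))
        exact le_mul_of_one_le_right (by positivity) (one_le_pow₀ (by norm_num))
      · refine le_trans (le_of_eq ?_) hDexp
        congr 1
        simp only [Fintype.card_fun, Fintype.card_bool, Fintype.card_fin]
        push_cast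
        rw [← pow_mul]
        congr 1
        ring)
  exact ⟨fun v x y => Fx (v, x) y, fun v x y => Fy (v, x) y,
    fx_strong ε hε.le K hK hme Fx hFx, fy_strong ε hε.le K hK hme Fy hFy⟩

theorem stmt16 :
    ∃ c C : ℝ, 1 < c ∧ 0 < C ∧
      ∀ a : ℕ, 1 ≤ a → ∀ ε : ℝ, 0 < ε → ∀ ℓ L m d1 d2 : ℕ, L = 2 ^ ℓ →
        ⌈c * (log2 (max d1 d2) + log2 (1 / ε))⌉₊ ≤ m →
        8 * a * ⌈c * (log2 (max d1 d2) + log2 (1 / ε))⌉₊ + 6 * m ≤ d1 →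
        (8 * a * (⌈c * (log2 (max d1 d2) + log2 (1 / ε))⌉₊ : ℝ)
            + c ^ (a * (log2 L) ^ ((1 : ℝ) / a))
              * (⌈c * (log2 (max d1 d2) + log2 (1 / ε))⌉₊ : ℝ)) ≤ (d2 : ℝ) →
        ∃ (Fx : (Fin L → BS m) → BS d1 → BS d2 → BS m)
          (Fy : (Fin L → BS m) → BS d1 → BS d2 →
              BS ⌈c * (log2 (max d1 d2) + log2 (1 / ε))⌉₊),
          IsNIPMStrongY Fx (C * L * ε) ∧ IsNIPMStrongX Fy (C * L * ε) := by
  refine ⟨2, 3, by norm_num, by norm_num, ?_⟩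
  intro a ha ε hε ℓ L m d1 d2 hL hm hd1 hd2
  set d := ⌈(2 : ℝ) * (log2 (max d1 d2) + log2 (1 / ε))⌉₊ with hd
  by_cases hbig : 1 ≤ 3 * (L : ℝ) * ε
  · exact ⟨fun _ _ _ _ => false, fun _ _ _ _ => false, trivial_Y _ _ hbig, trivial_X _ _ hbig⟩
  push Not at hbig
  have hL1 : 1 ≤ L := by rw [hL]; exact Nat.one_le_two_pow
  have hL1' : (1 : ℝ) ≤ L := by exact_mod_cast hL1
  have hε1 : ε < 1 := by nlinarith
  have had : d ≤ a * d := Nat.le_mul_of_pos_left d ha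
  have hd1' : 8 * d + 6 * m ≤ d1 := by
    have : 8 * a * d = 8 * (a * d) := by ring
    omega
  have hd2' : 9 * d ≤ d2 := by
    have h1 : (1 : ℝ) ≤ 2 ^ ((a : ℝ) * (log2 L) ^ ((1 : ℝ) / a)) := by
      refine Real.one_le_rpow (by norm_num) ?_
      refine mul_nonneg (by positivity) (Real.rpow_nonneg ?_ _)
      exact Real.logb_nonneg (by norm_num) hL1'
    have h2 : (d : ℝ) ≤ a * d := by exact_mod_cast had
    have h0 : (0 : ℝ) ≤ d := by positivity
    have : (9 * d : ℝ) ≤ d2 := by nlinarith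
    exact_mod_cast this
  have hlogε : 0 < log2 (1 / ε) := Real.logb_pos (by norm_num) (by rw [lt_div_iff₀ hε]; linarith)
  have hceil : (2 : ℝ) * (log2 (max d1 d2) + log2 (1 / ε)) ≤ d := Nat.le_ceil _
  have hM1 : (1 : ℝ) ≤ max (d1 : ℝ) (d2 : ℝ) := by
    by_contra hc
    push Not at hc
    have h1 : (d1 : ℝ) < 1 := lt_of_le_of_lt (le_max_left _ _) hc
    have h2 : (d2 : ℝ) < 1 := lt_of_le_of_lt (le_max_right _ _) hc
    have h1' : d1 = 0 := by
      have : d1 < 1 := by exact_mod_cast h1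
      omega
    have h2' : d2 = 0 := by
      have : d2 < 1 := by exact_mod_cast h2
      omega
    have hd0 : d = 0 := by omega
    rw [hd0, h1', h2'] at hceil
    simp only [log2, Nat.cast_zero, max_self, Real.logb_zero] at hceil hlogε
    linarith
  have hDq : (max (d1 : ℝ) (d2 : ℝ) / ε) ^ 2 ≤ (2 : ℝ) ^ d := by
    have hMpos : (0 : ℝ) < max (d1 : ℝ) (d2 : ℝ) := by linarith
    have hq : 0 < max (d1 : ℝ) (d2 : ℝ) / ε := by positivity
    have e : log2 (max d1 d2) + log2 (1 / ε) = Real.logb 2 (max (d1 : ℝ) (d2 : ℝ) / ε) := by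
      rw [log2, log2, ← Real.logb_mul hMpos.ne' (by positivity), mul_one_div]
    rw [e] at hceil
    rw [← Real.rpow_natCast 2 d, ← Real.logb_le_iff_le_rpow (by norm_num) (by positivity),
      Real.logb_pow]
    exact_mod_cast hceil
  obtain ⟨Fx, Fy, hx, hy⟩ := main_exists ε _ d L m d1 d2 hε hL1 hbig hM1 (le_max_left _ _)
    (le_max_right _ _) hDq hm hd1' hd2'
  have hle : 3 * ε ≤ 3 * (L : ℝ) * ε := by nlinarith
  exact ⟨Fx, Fy, mono_Y _ _ _ hle hx, mono_X _ _ _ hle hy⟩
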